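/- Let C be an m×n Cauchon diagram and let e and f be horizontal edges of the Cauchon graph G_C with all endpoints white squares, with row(f) ≤ row(e). If |col(e) ∩ col(f)| = 1 and either col_1(e) = col_1(f) or col_2(e) = col_2(f), then w(f)w(e) = q·w(e)w(f). -/

import Mathlib

universe u

/-- Quantum affine space data: a central unit `q` and units `t i j`
satisfying the quantum affine space commutation relations. -/
structure QMData (R : Type u) [Ring R] (m n : ℕ) where
  q : Rˣ
  t : Fin m → Fin n → Rˣ
  q_central : ∀ r : R, (q : R) * r = r * (q : R)
  row_rel : ∀ (i : Fin m) ⦃j j' : Fin n⦄, j < j' →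
    (t i j : R) * (t i j' : R) = (q : R) * ((t i j' : R) * (t i j : R))
  col_rel : ∀ ⦃i i' : Fin m⦄ (j : Fin n), i < i' →
    (t i j : R) * (t i' j : R) = (q : R) * ((t i' j : R) * (t i j : R))
  mixed_rel : ∀ ⦃i i' : Fin m⦄ ⦃j j' : Fin n⦄, i < i' → j ≠ j' →
    (t i j : R) * (t i' j' : R) = (t i' j' : R) * (t i j : R)

/-- `white i j = true` means the square `(i,j)` is white.  The Cauchon
condition: for every black square, either every square above it or every
square to its left is also black. -/
def IsCauchon {m n : ℕ} (white : Fin m → Fin n → Bool) : Prop :=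
  ∀ i j, white i j = false →
    (∀ i' : Fin m, i' < i → white i' j = false) ∨
    (∀ j' : Fin n, j' < j → white i j' = false)

/-- Vertices of the Cauchon graph: white squares, row vertices `r_i`,
column vertices `c_j`. -/
inductive CVertex (m n : ℕ) where
  | sq : Fin m → Fin n → CVertex m n
  | row : Fin m → CVertex m n
  | col : Fin n → CVertex m n
deriving DecidableEq

/-- Directed edges of the Cauchon graph. -/
inductive CEdge {m n : ℕ} (white : Fin m → Fin n → Bool) :
    CVertex m n → CVertex m n → Prop where
  | fromRow (i : Fin m) (k : Fin n) :
      white i k = true → (∀ k' : Fin n, k < k' → white i k' = false) →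
      CEdge white (.row i) (.sq i k)
  | toCol (i : Fin m) (j : Fin n) :
      white i j = true → (∀ i' : Fin m, i < i' → white i' j = false) →
      CEdge white (.sq i j) (.col j)
  | horiz (i : Fin m) (k j : Fin n) :
      j < k → white i k = true → white i j = true →
      (∀ j' : Fin n, j < j' → j' < k → white i j' = false) →
      CEdge white (.sq i k) (.sq i j)
  | vert (i i' : Fin m) (j : Fin n) :
      i < i' → white i j = true → white i' j = true →
      (∀ l : Fin m, i < l → l < i' → white l j = false) →
      CEdge white (.sq i j) (.sq i' j)

/-- The weight of an edge of the Cauchon graph (1 on non-edges). -/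
def wt {R : Type u} {m n : ℕ} [Ring R] (D : QMData R m n) :
    CVertex m n → CVertex m n → R
  | .row i, .sq i' k => if i = i' then (D.t i' k : R) else 1
  | .sq i k, .sq i' j =>
      if i = i' ∧ j < k then (↑((D.t i k)⁻¹) * ↑(D.t i j) : R) else 1
  | _, _ => 1

/-- A pair of vertices spans a horizontal edge (edges from `r_i` are
horizontal; edges between squares are horizontal iff the rows agree). -/
def Horiz {m n : ℕ} : CVertex m n → CVertex m n → Prop
  | .row _, _ => True
  | .sq i _, .sq i' _ => i = i'
  | _, _ => False

/-- `l` is (the list of vertices of) a directed path from `u` to `v`. -/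
def IsPathFrom {m n : ℕ} (white : Fin m → Fin n → Bool) (u v : CVertex m n)
    (l : List (CVertex m n)) : Prop :=
  l.Chain' (CEdge white) ∧ l.head? = some u ∧ l.getLast? = some v

/-- The list of (endpoint pairs of the) edges of a path. -/
def steps {m n : ℕ} (l : List (CVertex m n)) : List (CVertex m n × CVertex m n) :=
  l.zip l.tail

/-- The weight of a path: the ordered product of its edge weights. -/
def pathWeight {R : Type u} {m n : ℕ} [Ring R] (D : QMData R m n)
    (l : List (CVertex m n)) : R :=
  ((steps l).map fun p => wt D p.1 p.2).prod

/-- The number of inversions (length) of a permutation of `Fin k`. -/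
def invCount {k : ℕ} (σ : Equiv.Perm (Fin k)) : ℕ :=
  ((Finset.univ : Finset (Fin k × Fin k)).filter fun p => p.1 < p.2 ∧ σ p.2 < σ p.1).card

/-- The quantum determinant of a `k × k` matrix over a (noncommutative) ring. -/
def qdet {R : Type u} [Ring R] {k : ℕ} (q : Rˣ) (N : Matrix (Fin k) (Fin k) R) : R :=
  ∑ σ : Equiv.Perm (Fin k),
    (-(q : R)) ^ invCount σ * ((List.finRange k).map fun i => N i (σ i)).prod

/-- The path matrix: entry `(i,j)` is the sum of the weights of all directed
paths from `r_i` to `c_j` (zero when there are none). -/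
noncomputable def pathMatrix {R : Type u} {m n : ℕ} [Ring R] (D : QMData R m n)
    (white : Fin m → Fin n → Bool) : Matrix (Fin m) (Fin n) R :=
  Matrix.of fun i j =>
    ∑ᶠ p : {l : List (CVertex m n) // IsPathFrom white (.row i) (.col j) l},
      pathWeight D p.1

/-- An `(R_I, C_J)`-path system: paths `P ℓ : r_{i_ℓ} ⇒ c_{j_{σ ℓ}}`. -/
structure PathSys {m n : ℕ} (white : Fin m → Fin n → Bool) {k : ℕ}
    (ι : Fin k → Fin m) (κ : Fin k → Fin n) where
  σ : Equiv.Perm (Fin k)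
  P : Fin k → List (CVertex m n)
  isPath : ∀ l : Fin k, IsPathFrom white (.row (ι l)) (.col (κ (σ l))) (P l)

/-- A path system is vertex-disjoint if no two of its paths share a vertex. -/
def PathSys.VertexDisjoint {m n : ℕ} {white : Fin m → Fin n → Bool} {k : ℕ}
    {ι : Fin k → Fin m} {κ : Fin k → Fin n} (S : PathSys white ι κ) : Prop :=
  ∀ a b : Fin k, a ≠ b → ∀ x : CVertex m n, x ∈ S.P a → x ∈ S.P b → False

/-- The weight of a path system: the ordered product `w(P₁)⋯w(P_k)`. -/
def PathSys.weight {R : Type u} {m n : ℕ} [Ring R] (D : QMData R m n)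
    {white : Fin m → Fin n → Bool} {k : ℕ} {ι : Fin k → Fin m} {κ : Fin k → Fin n}
    (S : PathSys white ι κ) : R :=
  ((List.finRange k).map fun l => pathWeight D (S.P l)).prod

/-- The `q`-sign of a path system: `(-q) ^ ℓ(σ_P)`. -/
def PathSys.sgnq {R : Type u} {m n : ℕ} [Ring R] (D : QMData R m n)
    {white : Fin m → Fin n → Bool} {k : ℕ} {ι : Fin k → Fin m} {κ : Fin k → Fin n}
    (S : PathSys white ι κ) : R :=
  (-(D.q : R)) ^ invCount S.σ


/-- If `a, c` and `b, d` commute up to central factors `p` and `r`, while `b, c` and `a, d` commute,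
then `a⁻¹ * b` and `c⁻¹ * d` commute up to the factor `p * r`. -/
theorem inv_mul_mul_inv_mul_of_commute_up_to {G : Type*} [Group G] {a b c d p r : G}
    (hp : ∀ x, Commute p x) (hr : ∀ x, Commute r x)
    (hac : a * c = p * (c * a)) (hbd : b * d = r * (d * b))
    (hbc : Commute b c) (had : Commute a d) :
    a⁻¹ * b * (c⁻¹ * d) = p * r * (c⁻¹ * d * (a⁻¹ * b)) := by
  have hinv : a⁻¹ * c⁻¹ = p * (c⁻¹ * a⁻¹) := by
    rw [← mul_inv_rev a c, hac, mul_inv_rev, mul_inv_rev, ((hp _).inv_left.eq).symm]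
    group
  calc a⁻¹ * b * (c⁻¹ * d) = a⁻¹ * (b * c⁻¹) * d := by group
    _ = a⁻¹ * c⁻¹ * (b * d) := by rw [hbc.inv_right.eq]; group
    _ = p * (c⁻¹ * a⁻¹ * r) * (d * b) := by rw [hinv, hbd]; group
    _ = p * r * c⁻¹ * (a⁻¹ * d) * b := by rw [← (hr _).eq]; group
    _ = p * r * (c⁻¹ * d * (a⁻¹ * b)) := by rw [had.inv_left.eq]; group

/-- A white square is the source of at most one horizontal edge. -/
theorem CEdge.target_unique {m n : ℕ} {white : Fin m → Fin n → Bool} {i : Fin m} {k j j' : Fin n}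
    (h : CEdge white (.sq i k) (.sq i j)) (h' : CEdge white (.sq i k) (.sq i j')) : j = j' := by
  cases h with
  | vert _ _ _ hlt => exact absurd hlt (lt_irrefl _)
  | horiz _ _ _ hj _ hw hb =>
    cases h' with
    | vert _ _ _ hlt => exact absurd hlt (lt_irrefl _)
    | horiz _ _ _ hj' _ hw' hb' =>
      rcases lt_trichotomy j j' with hlt | heq | hlt
      · simp [hb _ hlt hj'] at hw'
      · exact heq
      · simp [hb' _ hlt hj] at hw

/-- A white square is the target of at most one horizontal edge. -/
theorem CEdge.source_unique {m n : ℕ} {white : Fin m → Fin n → Bool} {i : Fin m} {k k' j : Fin n}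
    (h : CEdge white (.sq i k) (.sq i j)) (h' : CEdge white (.sq i k') (.sq i j)) : k = k' := by
  cases h with
  | vert _ _ _ hlt => exact absurd hlt (lt_irrefl _)
  | horiz _ _ _ hj hw _ hb =>
    cases h' with
    | vert _ _ _ hlt => exact absurd hlt (lt_irrefl _)
    | horiz _ _ _ hj' hw' _ hb' =>
      rcases lt_trichotomy k k' with hlt | heq | hlt
      · simp [hb' _ hj hlt] at hw
      · exact heq
      · simp [hb _ hj' hlt] at hw'

/-- horizontal edges `e,f` (white endpoints, `row f ≤ row e`) with
`|col(e) ∩ col(f)| = 1` and `col₁(e) = col₁(f)` or `col₂(e) = col₂(f)`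
satisfy `w(f)w(e) = q·w(e)w(f)`. -/
theorem edge_comm_one_common_aligned {R : Type u} [Ring R] {m n : ℕ} (D : QMData R m n)
    (white : Fin m → Fin n → Bool) (hC : IsCauchon white)
    (re rf : Fin m) (ke je kf jf : Fin n) (hje : je < ke) (hjf : jf < kf)
    (he : CEdge white (.sq re ke) (.sq re je))
    (hf : CEdge white (.sq rf kf) (.sq rf jf))
    (hrow : rf ≤ re)
    (hcard : (({ke, je} : Finset (Fin n)) ∩ ({kf, jf} : Finset (Fin n))).card = 1)
    (hcase : ke = kf ∨ je = jf) :
    (↑((D.t rf kf)⁻¹) * ↑(D.t rf jf) : R) * (↑((D.t re ke)⁻¹) * ↑(D.t re je)) =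
      ↑D.q * ((↑((D.t re ke)⁻¹) * ↑(D.t re je) : R) * (↑((D.t rf kf)⁻¹) * ↑(D.t rf jf))) := by
  have hne : ¬(ke = kf ∧ je = jf) := by
    rintro ⟨rfl, rfl⟩
    rw [Finset.inter_self, Finset.card_pair hje.ne'] at hcard
    omega
  have hlt : rf < re := by
    refine lt_of_le_of_ne hrow ?_
    rintro rfl
    rcases hcase with rfl | rfl
    · exact hne ⟨rfl, he.target_unique hf⟩
    · exact hne ⟨he.source_unique hf, rfl⟩
  have hq : ∀ x, Commute D.q x := fun x => Units.ext (D.q_central x)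
  have hcol : ∀ j, D.t rf j * D.t re j = D.q * (D.t re j * D.t rf j) := fun j =>
    Units.ext (D.col_rel j hlt)
  have hmixed : ∀ {j j'}, j ≠ j' → Commute (D.t rf j) (D.t re j') := fun h =>
    Units.ext (D.mixed_rel hlt h)
  suffices h : (D.t rf kf)⁻¹ * D.t rf jf * ((D.t re ke)⁻¹ * D.t re je) =
      D.q * ((D.t re ke)⁻¹ * D.t re je * ((D.t rf kf)⁻¹ * D.t rf jf)) from
    congrArg Units.val h
  rcases hcase with rfl | rfl
  · have hj : jf ≠ je := fun h => hne ⟨rfl, h.symm⟩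
    simpa using inv_mul_mul_inv_mul_of_commute_up_to hq Commute.one_left (hcol ke)
      (by simpa using (hmixed hj).eq) (hmixed hjf.ne) (hmixed hje.ne')
  · have hk : kf ≠ ke := fun h => hne ⟨h.symm, rfl⟩
    simpa using inv_mul_mul_inv_mul_of_commute_up_to Commute.one_left hq
      (by simpa using (hmixed hk).eq) (hcol je) (hmixed hje.ne) (hmixed hjf.ne')
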